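/- arXiv:2003.05607 — 2 statements merged into one kernel-verified Lean document; each statement's English description precedes it below -/
import Mathlib

section
/- Let R be a ring in which the product of two-sided ideals is commutative, i.e., IJ = JI for all two-sided ideals I, J of R. Then (I :ℓ J) = (I :r J) for all two-sided ideals I, J of R. -/
/-- The product of two-sided ideals: the two-sided ideal generated by the
products `a * b` with `a ∈ I`, `b ∈ J`. -/
def prodTI {R : Type*} [Ring R] (I J : TwoSidedIdeal R) : TwoSidedIdeal R :=
  TwoSidedIdeal.span {x | ∃ a ∈ I, ∃ b ∈ J, x = a * b}

namespace TwoSidedIdeal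

variable {R : Type*} [Ring R]

/-- The left colon ideal `(I :ℓ J)`, the set of `r` with `r * b ∈ I` for all `b ∈ J`. -/
def leftColon (I J : TwoSidedIdeal R) : TwoSidedIdeal R :=
  .mk' {r : R | ∀ b ∈ J, r * b ∈ I}
    (fun b _ => by simp [I.zero_mem])
    (fun hx hy b hb => by simpa [add_mul] using I.add_mem (hx b hb) (hy b hb))
    (fun hx b hb => by simpa using I.neg_mem (hx b hb))
    (fun {x y} hy b hb => by simpa [mul_assoc] using I.mul_mem_left x _ (hy b hb))
    (fun {x y} hx b hb => by simpa [mul_assoc] using hx (y * b) (J.mul_mem_left y b hb))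

/-- The right colon ideal `(I :r J)`, the set of `r` with `b * r ∈ I` for all `b ∈ J`. -/
def rightColon (I J : TwoSidedIdeal R) : TwoSidedIdeal R :=
  .mk' {r : R | ∀ b ∈ J, b * r ∈ I}
    (fun b _ => by simp [I.zero_mem])
    (fun hx hy b hb => by simpa [mul_add] using I.add_mem (hx b hb) (hy b hb))
    (fun hx b hb => by simpa using I.neg_mem (hx b hb))
    (fun {x y} hy b hb => by simpa [mul_assoc] using hy (b * x) (J.mul_mem_right b x hb))
    (fun {x y} hx b hb => by simpa [mul_assoc] using I.mul_mem_right _ y (hx b hb))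

@[simp]
lemma mem_leftColon {I J : TwoSidedIdeal R} {r : R} :
    r ∈ leftColon I J ↔ ∀ b ∈ J, r * b ∈ I :=
  mem_mk' ..

@[simp]
lemma mem_rightColon {I J : TwoSidedIdeal R} {r : R} :
    r ∈ rightColon I J ↔ ∀ b ∈ J, b * r ∈ I :=
  mem_mk' ..

lemma prodTI_le_iff {I J K : TwoSidedIdeal R} :
    prodTI I J ≤ K ↔ ∀ a ∈ I, ∀ b ∈ J, a * b ∈ K := by
  rw [prodTI, span_le]
  constructor
  · exact fun h a ha b hb => h ⟨a, ha, b, hb, rfl⟩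
  · rintro h _ ⟨a, ha, b, hb, rfl⟩
    exact h a ha b hb

end TwoSidedIdeal

open TwoSidedIdeal in
/-- Let `R` be a ring in which the product of two-sided ideals is commutative.
Then `(I :ℓ J) = (I :r J)` for all two-sided ideals `I, J`. -/
theorem stmt_15 {R : Type*} [Ring R]
    (hcomm : ∀ I J : TwoSidedIdeal R, prodTI I J = prodTI J I)
    (I J : TwoSidedIdeal R) :
    {r : R | ∀ b ∈ J, r * b ∈ I} = {r : R | ∀ b ∈ J, b * r ∈ I} := by
  have hl : prodTI J (leftColon I J) ≤ I :=
    hcomm (leftColon I J) J ▸ prodTI_le_iff.2 fun _ ha => mem_leftColon.1 ha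
  have hr : prodTI (rightColon I J) J ≤ I :=
    hcomm J (rightColon I J) ▸ prodTI_le_iff.2 fun b hb _ ha => mem_rightColon.1 ha b hb
  ext r
  exact ⟨fun h b hb => prodTI_le_iff.1 hl b hb r (mem_leftColon.2 h),
    fun h => prodTI_le_iff.1 hr r (mem_rightColon.2 h)⟩
end

section
/- Let R be a prime (left and right) Noetherian ring whose set of regular elements satisfies the Ore conditions, so that the classical quotient ring Q = Q_cl(R) exists and R ⊆ Q. Consider the conditions: (1) R is an Asano prime ring (every nonzero two-sided ideal of R is invertible); (3) the product of two-sided ideals of R is commutative and (A :ℓ B) + (B :ℓ A) = R for all ideals A, B; (4) the product of ideals is commutative and (A + B :ℓ C) = (A :ℓ C) + (B :ℓ C) for all ideals A, B, C; (5) the product of ideals is commutative and (A :ℓ B ∩ C) = (A :ℓ B) + (A :ℓ C) for all ideals A, B, C. Then (1) implies (3), and (3), (4), (5) are pairwise equivalent. If moreover each ideal A of R can be written as Rc₁ + ⋯ + Rc_m = A = d₁R + ⋯ + d_nR with each Rc_j and each d_iR a two-sided ideal of R, then all of (1), (3), (4), (5) are equivalent. -/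
/-- `(A :ℓ B) = {x | x·B ⊆ A}`. -/
def colonSetL {α : Type*} [Mul α] (A B : Set α) : Set α :=
  {x | ∀ b ∈ B, x * b ∈ A}

/-- The sum of two subsets of a ring: `X + Y = {x + y | x ∈ X, y ∈ Y}`. -/
def sumSet {α : Type*} [Add α] (X Y : Set α) : Set α :=
  {z | ∃ x ∈ X, ∃ y ∈ Y, z = x + y}

/-- An additive subgroup `X` of `Q` is an `R`-sub-bimodule (via `f : R →+* Q`)
if it is closed under left and right multiplication by elements of `R`. -/
def IsSubBimodule {R Q : Type*} [Ring R] [Ring Q] (f : R →+* Q)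
    (X : AddSubgroup Q) : Prop :=
  ∀ r : R, ∀ x ∈ X, f r * x ∈ X ∧ x * f r ∈ X

/-- The product of two additive subgroups of a ring: the additive subgroup
generated by the products. -/
def mulGrp {Q : Type*} [Ring Q] (X Y : AddSubgroup Q) : AddSubgroup Q :=
  AddSubgroup.closure {q | ∃ x ∈ X, ∃ y ∈ Y, q = x * y}

/-- A two-sided ideal `I` of `R` is invertible (inside `Q ⊇ R`) if there is an
`R`-sub-bimodule `X` of `Q` with `X·I = R = I·X`. -/
def IsInvertibleIdeal {R Q : Type*} [Ring R] [Ring Q] (f : R →+* Q)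
    (I : TwoSidedIdeal R) : Prop :=
  ∃ X : AddSubgroup Q, IsSubBimodule f X ∧
    mulGrp X (AddSubgroup.closure (f '' I)) = AddSubgroup.closure (Set.range f) ∧
    mulGrp (AddSubgroup.closure (f '' I)) X = AddSubgroup.closure (Set.range f)

/-- Condition (1): `R` is an Asano prime ring, i.e. every nonzero two-sided
ideal is invertible. -/
def CondAsano {R Q : Type*} [Ring R] [Ring Q] (f : R →+* Q) : Prop :=
  ∀ A : TwoSidedIdeal R, A ≠ ⊥ → IsInvertibleIdeal f A

/-- The product of two-sided ideals of `R` is commutative. -/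
def CondComm (R : Type*) [Ring R] : Prop :=
  ∀ I J : TwoSidedIdeal R, prodTI I J = prodTI J I

/-- Condition (3): commutative ideal product and `(A :ℓ B) + (B :ℓ A) = R`. -/
def CondSDML (R : Type*) [Ring R] : Prop :=
  CondComm R ∧ ∀ A B : TwoSidedIdeal R,
    sumSet (colonSetL (A : Set R) (B : Set R)) (colonSetL (B : Set R) (A : Set R)) =
      Set.univ

/-- Condition (4): commutative ideal product and
`(A + B :ℓ C) = (A :ℓ C) + (B :ℓ C)`. -/
def CondSDML1 (R : Type*) [Ring R] : Prop :=
  CondComm R ∧ ∀ A B C : TwoSidedIdeal R,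
    colonSetL ((A ⊔ B : TwoSidedIdeal R) : Set R) (C : Set R) =
      sumSet (colonSetL (A : Set R) (C : Set R)) (colonSetL (B : Set R) (C : Set R))

/-- Condition (5): commutative ideal product and
`(A :ℓ B ∩ C) = (A :ℓ B) + (A :ℓ C)`. -/
def CondSDML2 (R : Type*) [Ring R] : Prop :=
  CondComm R ∧ ∀ A B C : TwoSidedIdeal R,
    colonSetL (A : Set R) ((B : Set R) ∩ (C : Set R)) =
      sumSet (colonSetL (A : Set R) (B : Set R)) (colonSetL (A : Set R) (C : Set R))

section Ideals

variable {R : Type*} [Ring R]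

/-- The colon `(A :ℓ B)` of two-sided ideals, as a two-sided ideal. -/
def colonTI (A B : TwoSidedIdeal R) : TwoSidedIdeal R :=
  TwoSidedIdeal.mk' (colonSetL (A : Set R) (B : Set R))
    (fun b _ => by simp)
    (fun hx hy b hb => by rw [add_mul]; exact A.add_mem (hx b hb) (hy b hb))
    (fun hx b hb => by rw [neg_mul]; exact A.neg_mem (hx b hb))
    (fun hy b hb => by rw [mul_assoc]; exact A.mul_mem_left _ _ (hy b hb))
    (fun {x y} hx b hb => by rw [mul_assoc]; exact hx _ (B.mul_mem_left y b hb))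

theorem mem_colonTI {A B : TwoSidedIdeal R} {x : R} :
    x ∈ colonTI A B ↔ ∀ b ∈ B, x * b ∈ A :=
  TwoSidedIdeal.mem_mk' ..

theorem mem_sumSet_colonSetL {A B C D : TwoSidedIdeal R} {x : R} :
    x ∈ sumSet (colonSetL (A : Set R) (B : Set R)) (colonSetL (C : Set R) (D : Set R)) ↔
      x ∈ colonTI A B ⊔ colonTI C D := by
  rw [TwoSidedIdeal.mem_sup]
  simp only [mem_colonTI]
  constructor
  · rintro ⟨y, hy, z, hz, rfl⟩
    exact ⟨y, hy, z, hz, rfl⟩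
  · rintro ⟨y, hy, z, hz, rfl⟩
    exact ⟨y, hy, z, hz, rfl⟩

theorem prodTI_mem {I J : TwoSidedIdeal R} {a b : R} (ha : a ∈ I) (hb : b ∈ J) :
    a * b ∈ prodTI I J :=
  TwoSidedIdeal.subset_span ⟨a, ha, b, hb, rfl⟩

theorem prodTI_le {I J K : TwoSidedIdeal R} :
    prodTI I J ≤ K ↔ ∀ a ∈ I, ∀ b ∈ J, a * b ∈ K := by
  refine ⟨fun h a ha b hb => h (prodTI_mem ha hb), fun h => TwoSidedIdeal.span_le.2 ?_⟩
  rintro _ ⟨a, ha, b, hb, rfl⟩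
  exact h a ha b hb

theorem prodTI_le_left (I J : TwoSidedIdeal R) : prodTI I J ≤ I :=
  prodTI_le.2 fun _ ha _ _ => I.mul_mem_right _ _ ha

theorem prodTI_le_right (I J : TwoSidedIdeal R) : prodTI I J ≤ J :=
  prodTI_le.2 fun _ _ _ hb => J.mul_mem_left _ _ hb

theorem prodTI_bot (I : TwoSidedIdeal R) : prodTI I ⊥ = ⊥ :=
  le_bot_iff.1 (prodTI_le_right I ⊥)

theorem bot_prodTI (I : TwoSidedIdeal R) : prodTI ⊥ I = ⊥ :=
  le_bot_iff.1 (prodTI_le_left ⊥ I)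

theorem prodTI_top (I : TwoSidedIdeal R) : prodTI I ⊤ = I :=
  le_antisymm (prodTI_le_left I ⊤) fun x hx => by
    simpa using prodTI_mem hx (TwoSidedIdeal.mem_top R (x := (1 : R)))

theorem top_prodTI (I : TwoSidedIdeal R) : prodTI ⊤ I = I :=
  le_antisymm (prodTI_le_right ⊤ I) fun x hx => by
    simpa using prodTI_mem (TwoSidedIdeal.mem_top R (x := (1 : R))) hx

theorem colonTI_bot_eq_bot
    (hprime : ∀ I J : TwoSidedIdeal R, prodTI I J = ⊥ → I = ⊥ ∨ J = ⊥)
    {A : TwoSidedIdeal R} (hA : A ≠ ⊥) : colonTI ⊥ A = ⊥ :=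
  (hprime _ A (le_bot_iff.1 (prodTI_le.2 fun _ hx b hb => mem_colonTI.1 hx b hb))).resolve_right hA

theorem eq_zero_or_eq_zero_of_prime
    (hprime : ∀ I J : TwoSidedIdeal R, prodTI I J = ⊥ → I = ⊥ ∨ J = ⊥)
    (a b : R) (h : ∀ r, a * r * b = 0) : a = 0 ∨ b = 0 := by
  let B : TwoSidedIdeal R := TwoSidedIdeal.mk' {x | ∀ r, a * r * x = 0}
    (fun r => mul_zero _)
    (fun {x y} hx hy r => by rw [mul_add, hx r, hy r, add_zero])
    (fun {x} hx r => by rw [mul_neg, hx r, neg_zero])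
    (fun {s x} hx r => by rw [← mul_assoc, mul_assoc a r s, hx (r * s)])
    (fun {x s} hx r => by rw [← mul_assoc, hx r, zero_mul])
  have hB : ∀ x, x ∈ B ↔ ∀ r, a * r * x = 0 := fun x => by
    rw [TwoSidedIdeal.mem_mk']; rfl
  by_cases hb : B = ⊥
  · right
    have : b ∈ B := (hB b).2 h
    rwa [hb] at this
  · left
    have : a ∈ colonTI ⊥ B := mem_colonTI.2 fun x hx => by
      rw [TwoSidedIdeal.mem_bot]
      simpa using (hB x).1 hx 1
    rwa [colonTI_bot_eq_bot hprime hb] at this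

theorem isRegular_of_forall_mul_eq [IsNoetherianRing R]
    (hp : ∀ a b : R, (∀ r, a * r * b = 0) → a = 0 ∨ b = 0)
    {c : R} (hc : c ≠ 0) (h : ∀ t, ∃ r, c * t = r * c) : IsRegular c := by
  have hl : ∀ x, c * x = 0 → x = 0 := fun x hx => by
    refine (hp c x fun r => ?_).resolve_left hc
    obtain ⟨r', hr'⟩ := h r
    rw [hr', mul_assoc, hx, mul_zero]
  have hln : ∀ n x, c ^ n * x = 0 → x = 0 := fun n => by
    induction n with
    | zero => simp
    | succ n ih =>
      intro x hx
      rw [pow_succ, mul_assoc] at hx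
      exact hl x (ih _ hx)
  have hn : ∀ n t, ∃ r, c ^ n * t = r * c ^ n := fun n => by
    induction n with
    | zero => exact fun t => ⟨t, by simp⟩
    | succ n ih =>
      intro t
      obtain ⟨r, hr⟩ := h t
      obtain ⟨s, hs⟩ := ih r
      exact ⟨s, by rw [pow_succ, mul_assoc, hr, ← mul_assoc, hs, mul_assoc]⟩
  let g : ℕ →o Submodule R R :=
    { toFun := fun n => LinearMap.ker (LinearMap.toSpanSingleton R R (c ^ n))
      monotone' := monotone_nat_of_le_succ fun n x hx => by
        simp only [LinearMap.mem_ker, LinearMap.toSpanSingleton_apply, smul_eq_mul] at hx ⊢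
        rw [pow_succ, ← mul_assoc, hx, zero_mul] }
  obtain ⟨n, hstab⟩ := monotone_stabilizes_iff_noetherian.2 ‹IsNoetherianRing R› g
  refine ⟨isLeftRegular_of_non_zero_divisor c hl,
    isRightRegular_of_non_zero_divisor c fun x hx => ?_⟩
  obtain ⟨t, ht⟩ := hn n x
  have h1 : t ∈ g (n + 1) := by
    change t * c ^ (n + 1) = 0
    rw [pow_succ, ← mul_assoc, ← ht, mul_assoc, hx, mul_zero]
  rw [← hstab (n + 1) n.le_succ] at h1
  exact hln n x (ht.trans h1)

theorem isRegular_of_forall_mul_eq' [IsNoetherianRing Rᵐᵒᵖ]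
    (hp : ∀ a b : R, (∀ r, a * r * b = 0) → a = 0 ∨ b = 0)
    {d : R} (hd : d ≠ 0) (h : ∀ t, ∃ r, t * d = d * r) : IsRegular d := by
  refine isRegular_op.1 (isRegular_of_forall_mul_eq (fun a b hab => ?_)
    (mt (MulOpposite.op_eq_zero_iff d).1 hd) fun t => ?_)
  · rw [← MulOpposite.unop_eq_zero_iff a, ← MulOpposite.unop_eq_zero_iff b]
    refine (hp b.unop a.unop fun r => ?_).symm
    rw [mul_assoc]
    exact congrArg MulOpposite.unop (hab (MulOpposite.op r))
  · obtain ⟨r, hr⟩ := h t.unop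
    exact ⟨MulOpposite.op r, congrArg MulOpposite.op hr⟩

instance TwoSidedIdeal.wellFoundedGT [IsNoetherianRing R] : WellFoundedGT (TwoSidedIdeal R) :=
  StrictMono.wellFoundedGT (f := fun I : TwoSidedIdeal R => TwoSidedIdeal.asIdeal I)
    fun _ _ h => h

/-! ### Equivalence of the distributivity conditions -/

theorem sumSet_colonSetL_eq_univ_iff {A B : TwoSidedIdeal R} :
    sumSet (colonSetL (A : Set R) (B : Set R)) (colonSetL (B : Set R) (A : Set R)) = Set.univ ↔
      ∃ u ∈ colonTI A B, ∃ v ∈ colonTI B A, u + v = 1 := by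
  rw [← TwoSidedIdeal.mem_sup, TwoSidedIdeal.one_mem_iff, Set.eq_univ_iff_forall, eq_top_iff]
  simp only [mem_sumSet_colonSetL]
  exact ⟨fun h x _ => h x, fun h x => h (TwoSidedIdeal.mem_top R)⟩

theorem condSDML_iff_condSDML1 : CondSDML R ↔ CondSDML1 R := by
  simp only [CondSDML, CondSDML1, sumSet_colonSetL_eq_univ_iff]
  refine and_congr_right fun _ => ⟨fun h A B C => ?_, fun h A B => ?_⟩
  · obtain ⟨u, hu, v, hv, huv⟩ := h A B
    rw [mem_colonTI] at hu hv
    ext x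
    constructor
    · intro hx
      refine ⟨u * x, fun c hc => ?_, v * x, fun c hc => ?_, by rw [← add_mul, huv, one_mul]⟩
      · obtain ⟨a, ha, b, hb, hab⟩ := TwoSidedIdeal.mem_sup.1 (hx c hc)
        rw [mul_assoc, ← hab, mul_add]
        exact A.add_mem (A.mul_mem_left _ _ ha) (hu b hb)
      · obtain ⟨a, ha, b, hb, hab⟩ := TwoSidedIdeal.mem_sup.1 (hx c hc)
        rw [mul_assoc, ← hab, mul_add]
        exact B.add_mem (hv a ha) (B.mul_mem_left _ _ hb)
    · rintro ⟨y, hy, z, hz, rfl⟩ c hc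
      rw [add_mul]
      exact (A ⊔ B).add_mem (TwoSidedIdeal.mem_sup_left (hy c hc))
        (TwoSidedIdeal.mem_sup_right (hz c hc))
  · have h1 : (1 : R) ∈ colonSetL ((A ⊔ B : TwoSidedIdeal R) : Set R)
        ((A ⊔ B : TwoSidedIdeal R) : Set R) := fun b hb => by rwa [one_mul]
    rw [h] at h1
    obtain ⟨u, hu, v, hv, huv⟩ := h1
    exact ⟨u, mem_colonTI.2 fun b hb => hu b (TwoSidedIdeal.mem_sup_right hb),
      v, mem_colonTI.2 fun a ha => hv a (TwoSidedIdeal.mem_sup_left ha), huv.symm⟩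

theorem condSDML_iff_condSDML2 : CondSDML R ↔ CondSDML2 R := by
  simp only [CondSDML, CondSDML2, sumSet_colonSetL_eq_univ_iff]
  refine and_congr_right fun _ => ⟨fun h A B C => ?_, fun h A B => ?_⟩
  · obtain ⟨u, hu, v, hv, huv⟩ := h C B
    rw [mem_colonTI] at hu hv
    ext x
    constructor
    · intro hx
      refine ⟨x * u, fun b hb => ?_, x * v, fun c hc => ?_, by rw [← mul_add, huv, mul_one]⟩
      · rw [mul_assoc]
        exact hx _ ⟨B.mul_mem_left _ _ hb, hu b hb⟩
      · rw [mul_assoc]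
        exact hx _ ⟨hv c hc, C.mul_mem_left _ _ hc⟩
    · rintro ⟨y, hy, z, hz, rfl⟩ c hc
      rw [add_mul]
      exact A.add_mem (hy c hc.1) (hz c hc.2)
  · have hset : ((B ⊓ A : TwoSidedIdeal R) : Set R) = (B : Set R) ∩ (A : Set R) := by
      ext x
      exact TwoSidedIdeal.mem_inf R
    have h1 : (1 : R) ∈ colonSetL ((B ⊓ A : TwoSidedIdeal R) : Set R)
        ((B : Set R) ∩ (A : Set R)) := fun b hb => by rwa [one_mul, hset]
    rw [h] at h1
    obtain ⟨u, hu, v, hv, huv⟩ := h1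
    exact ⟨u, mem_colonTI.2 fun b hb => ((TwoSidedIdeal.mem_inf R).1 (hu b hb)).2,
      v, mem_colonTI.2 fun a ha => ((TwoSidedIdeal.mem_inf R).1 (hv a ha)).1, huv.symm⟩

theorem colonTI_sup_le (h : CondSDML1 R) (A B C : TwoSidedIdeal R) :
    colonTI (A ⊔ B) C ≤ colonTI A C ⊔ colonTI B C := fun x hx => by
  rw [← mem_sumSet_colonSetL, ← h.2]
  exact mem_colonTI.1 hx

theorem iSup_colonTI_eq_top
    (hprime : ∀ I J : TwoSidedIdeal R, prodTI I J = ⊥ → I = ⊥ ∨ J = ⊥) (h : CondSDML1 R)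
    {ι : Type*} [Finite ι] {A : TwoSidedIdeal R} (hA : A ≠ ⊥) {C : ι → TwoSidedIdeal R}
    (hC : A = ⨆ j, C j) : ⨆ j, colonTI (C j) A = ⊤ := by
  classical
  have := Fintype.ofFinite ι
  have key : ∀ s : Finset ι, colonTI (s.sup C) A ≤ s.sup fun j => colonTI (C j) A := fun s => by
    induction s using Finset.induction_on with
    | empty => simpa using (colonTI_bot_eq_bot hprime hA).le
    | insert j s _ ih =>
      rw [Finset.sup_insert, Finset.sup_insert]
      exact (colonTI_sup_le h _ _ _).trans (sup_le_sup_left ih _)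
  rw [← Finset.sup_univ_eq_iSup, eq_top_iff]
  refine le_trans (fun x _ => mem_colonTI.2 fun a ha => ?_) (key Finset.univ)
  rw [Finset.sup_univ_eq_iSup, ← hC]
  exact A.mul_mem_left _ _ ha

end Ideals

section Image

variable {R Q : Type*} [Ring R] [Ring Q] {f : R →+* Q}

/-- The image of a two-sided ideal, as a `ℤ`-submodule of the target ring. -/
def imageTI (f : R →+* Q) (I : TwoSidedIdeal R) : Submodule ℤ Q :=
  (AddSubgroup.closure (f '' (I : Set R))).toIntSubmodule

theorem mem_imageTI {I : TwoSidedIdeal R} {q : Q} : q ∈ imageTI f I ↔ ∃ a ∈ I, f a = q := by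
  have h : AddSubgroup.closure (f '' (I : Set R)) =
      (TwoSidedIdeal.asIdeal I).toAddSubgroup.map f.toAddMonoidHom := by
    rw [← AddSubgroup.closure_eq ((TwoSidedIdeal.asIdeal I).toAddSubgroup.map f.toAddMonoidHom)]
    rfl
  change q ∈ AddSubgroup.closure (f '' (I : Set R)) ↔ _
  rw [h]
  rfl

theorem imageTI_mono {I J : TwoSidedIdeal R} (h : I ≤ J) : imageTI f I ≤ imageTI f J :=
  fun _ hq => by
    obtain ⟨a, ha, rfl⟩ := mem_imageTI.1 hq
    exact mem_imageTI.2 ⟨a, h ha, rfl⟩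

theorem le_of_imageTI_le (hf : Function.Injective f) {I J : TwoSidedIdeal R}
    (h : imageTI f I ≤ imageTI f J) : I ≤ J := fun a ha => by
  obtain ⟨b, hb, hab⟩ := mem_imageTI.1 (h (mem_imageTI.2 ⟨a, ha, rfl⟩))
  rwa [← hf hab]

theorem imageTI_injective (hf : Function.Injective f) : Function.Injective (imageTI f) :=
  fun _ _ h => le_antisymm (le_of_imageTI_le hf h.le) (le_of_imageTI_le hf h.ge)

theorem imageTI_bot : imageTI f ⊥ = ⊥ :=
  le_bot_iff.1 fun q hq => by
    obtain ⟨a, ha, rfl⟩ := mem_imageTI.1 hq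
    rw [TwoSidedIdeal.mem_bot] at ha
    simp [ha]

theorem one_le_imageTI_top : 1 ≤ imageTI f ⊤ :=
  Submodule.one_le.2 (mem_imageTI.2 ⟨1, TwoSidedIdeal.mem_top R, map_one f⟩)

/-- The preimage of a bimodule over the image of `R`, as a two-sided ideal. -/
def comapTI (f : R →+* Q) (M : Submodule ℤ Q) (hl : imageTI f ⊤ * M ≤ M)
    (hr : M * imageTI f ⊤ ≤ M) : TwoSidedIdeal R :=
  TwoSidedIdeal.mk' {a | f a ∈ M}
    (by simp)
    (fun {x y} hx hy => by
      change f (x + y) ∈ M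
      rw [map_add]; exact M.add_mem hx hy)
    (fun {x} hx => by
      change f (-x) ∈ M
      rw [map_neg]; exact M.neg_mem hx)
    (fun {x y} hy => by
      change f (x * y) ∈ M
      rw [map_mul]
      exact hl (Submodule.mul_mem_mul (mem_imageTI.2 ⟨x, TwoSidedIdeal.mem_top R, rfl⟩) hy))
    (fun {x y} hx => by
      change f (x * y) ∈ M
      rw [map_mul]
      exact hr (Submodule.mul_mem_mul hx (mem_imageTI.2 ⟨y, TwoSidedIdeal.mem_top R, rfl⟩)))

theorem mem_comapTI {M : Submodule ℤ Q} {hl : imageTI f ⊤ * M ≤ M}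
    {hr : M * imageTI f ⊤ ≤ M} {a : R} : a ∈ comapTI f M hl hr ↔ f a ∈ M :=
  TwoSidedIdeal.mem_mk' ..

theorem imageTI_comapTI {M : Submodule ℤ Q} {hl : imageTI f ⊤ * M ≤ M}
    {hr : M * imageTI f ⊤ ≤ M} (hM : M ≤ imageTI f ⊤) : imageTI f (comapTI f M hl hr) = M := by
  refine le_antisymm (fun q hq => ?_) fun q hq => ?_
  · obtain ⟨a, ha, rfl⟩ := mem_imageTI.1 hq
    exact mem_comapTI.1 ha
  · obtain ⟨a, _, rfl⟩ := mem_imageTI.1 (hM hq)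
    exact mem_imageTI.2 ⟨a, mem_comapTI.2 hq, rfl⟩

theorem top_mul_imageTI (I : TwoSidedIdeal R) : imageTI f ⊤ * imageTI f I = imageTI f I := by
  refine le_antisymm (Submodule.mul_le.2 fun p hp q hq => ?_) ?_
  · obtain ⟨a, _, rfl⟩ := mem_imageTI.1 hp
    obtain ⟨b, hb, rfl⟩ := mem_imageTI.1 hq
    exact mem_imageTI.2 ⟨a * b, I.mul_mem_left _ _ hb, map_mul f a b⟩
  · exact (one_mul _).ge.trans (mul_le_mul' one_le_imageTI_top le_rfl)

theorem imageTI_mul_top (I : TwoSidedIdeal R) : imageTI f I * imageTI f ⊤ = imageTI f I := by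
  refine le_antisymm (Submodule.mul_le.2 fun p hp q hq => ?_) ?_
  · obtain ⟨a, ha, rfl⟩ := mem_imageTI.1 hp
    obtain ⟨b, _, rfl⟩ := mem_imageTI.1 hq
    exact mem_imageTI.2 ⟨a * b, I.mul_mem_right _ _ ha, map_mul f a b⟩
  · exact (mul_one _).ge.trans (mul_le_mul' le_rfl one_le_imageTI_top)

theorem imageTI_prodTI (I J : TwoSidedIdeal R) :
    imageTI f (prodTI I J) = imageTI f I * imageTI f J := by
  refine le_antisymm ?_ (Submodule.mul_le.2 fun p hp q hq => ?_)
  · have hl : imageTI f ⊤ * (imageTI f I * imageTI f J) ≤ imageTI f I * imageTI f J := by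
      rw [← mul_assoc, top_mul_imageTI]
    have hr : imageTI f I * imageTI f J * imageTI f ⊤ ≤ imageTI f I * imageTI f J := by
      rw [mul_assoc, imageTI_mul_top]
    have h : prodTI I J ≤ comapTI f _ hl hr := prodTI_le.2 fun a ha b hb => by
      rw [mem_comapTI, map_mul]
      exact Submodule.mul_mem_mul (mem_imageTI.2 ⟨a, ha, rfl⟩) (mem_imageTI.2 ⟨b, hb, rfl⟩)
    intro q hq
    obtain ⟨a, ha, rfl⟩ := mem_imageTI.1 hq
    exact mem_comapTI.1 (h ha)
  · obtain ⟨a, ha, rfl⟩ := mem_imageTI.1 hp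
    obtain ⟨b, hb, rfl⟩ := mem_imageTI.1 hq
    exact mem_imageTI.2 ⟨a * b, prodTI_mem ha hb, map_mul f a b⟩

theorem imageTI_sup (I J : TwoSidedIdeal R) :
    imageTI f (I ⊔ J) = imageTI f I ⊔ imageTI f J := by
  refine le_antisymm (fun q hq => ?_)
    (sup_le (imageTI_mono le_sup_left) (imageTI_mono le_sup_right))
  obtain ⟨a, ha, rfl⟩ := mem_imageTI.1 hq
  obtain ⟨b, hb, c, hc, rfl⟩ := TwoSidedIdeal.mem_sup.1 ha
  rw [map_add]
  exact Submodule.add_mem_sup (mem_imageTI.2 ⟨b, hb, rfl⟩) (mem_imageTI.2 ⟨c, hc, rfl⟩)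

theorem prodTI_assoc (I J K : TwoSidedIdeal R) :
    prodTI (prodTI I J) K = prodTI I (prodTI J K) :=
  imageTI_injective (f := RingHom.id R) Function.injective_id (by
    simp only [imageTI_prodTI, mul_assoc])

theorem sup_prodTI (I J K : TwoSidedIdeal R) :
    prodTI (I ⊔ J) K = prodTI I K ⊔ prodTI J K :=
  imageTI_injective (f := RingHom.id R) Function.injective_id (by
    simp only [imageTI_prodTI, imageTI_sup, Submodule.sup_mul])

theorem toIntSubmodule_mulGrp (X Y : AddSubgroup Q) :
    (mulGrp X Y).toIntSubmodule = X.toIntSubmodule * Y.toIntSubmodule := by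
  refine le_antisymm ?_ (Submodule.mul_le.2 fun x hx y hy =>
    AddSubgroup.subset_closure ⟨x, hx, y, hy, rfl⟩)
  have : mulGrp X Y ≤ (X.toIntSubmodule * Y.toIntSubmodule).toAddSubgroup := by
    refine (AddSubgroup.closure_le _).2 ?_
    rintro _ ⟨x, hx, y, hy, rfl⟩
    exact Submodule.mul_mem_mul (M := X.toIntSubmodule) (N := Y.toIntSubmodule) hx hy
  exact this

theorem imageTI_top : imageTI f ⊤ = (AddSubgroup.closure (Set.range f)).toIntSubmodule := by
  rw [imageTI, TwoSidedIdeal.coe_top, Set.image_univ]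

theorem isSubBimodule_iff {X : AddSubgroup Q} : IsSubBimodule f X ↔
    imageTI f ⊤ * X.toIntSubmodule ≤ X.toIntSubmodule ∧
      X.toIntSubmodule * imageTI f ⊤ ≤ X.toIntSubmodule := by
  refine ⟨fun h => ⟨Submodule.mul_le.2 fun p hp x hx => ?_,
    Submodule.mul_le.2 fun x hx p hp => ?_⟩, fun h r x hx => ⟨?_, ?_⟩⟩
  · obtain ⟨a, _, rfl⟩ := mem_imageTI.1 hp
    exact (h a x hx).1
  · obtain ⟨a, _, rfl⟩ := mem_imageTI.1 hp
    exact (h a x hx).2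
  · exact h.1 (Submodule.mul_mem_mul (N := X.toIntSubmodule)
      (mem_imageTI.2 ⟨r, TwoSidedIdeal.mem_top R, rfl⟩) hx)
  · exact h.2 (Submodule.mul_mem_mul (M := X.toIntSubmodule) hx
      (mem_imageTI.2 ⟨r, TwoSidedIdeal.mem_top R, rfl⟩))

theorem isInvertibleIdeal_iff {I : TwoSidedIdeal R} : IsInvertibleIdeal f I ↔
    ∃ X : Submodule ℤ Q, imageTI f ⊤ * X ≤ X ∧ X * imageTI f ⊤ ≤ X ∧
      X * imageTI f I = imageTI f ⊤ ∧ imageTI f I * X = imageTI f ⊤ := by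
  have e : ∀ X : AddSubgroup Q,
      (IsSubBimodule f X ∧
        mulGrp X (AddSubgroup.closure (f '' I)) = AddSubgroup.closure (Set.range f) ∧
        mulGrp (AddSubgroup.closure (f '' I)) X = AddSubgroup.closure (Set.range f)) ↔
      (imageTI f ⊤ * X.toIntSubmodule ≤ X.toIntSubmodule ∧
        X.toIntSubmodule * imageTI f ⊤ ≤ X.toIntSubmodule ∧
        X.toIntSubmodule * imageTI f I = imageTI f ⊤ ∧
        imageTI f I * X.toIntSubmodule = imageTI f ⊤) := fun X => by
    rw [isSubBimodule_iff, ← AddSubgroup.toIntSubmodule.injective.eq_iff, toIntSubmodule_mulGrp,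
      ← AddSubgroup.toIntSubmodule.injective.eq_iff, toIntSubmodule_mulGrp, ← imageTI_top,
      and_assoc]
    rfl
  unfold IsInvertibleIdeal
  simp only [e]
  exact ((AddSubgroup.toIntSubmodule (M := Q)).surjective.exists
    (p := fun X => imageTI f ⊤ * X ≤ X ∧ X * imageTI f ⊤ ≤ X ∧
      X * imageTI f I = imageTI f ⊤ ∧ imageTI f I * X = imageTI f ⊤)).symm

end Image

section Asano

variable {R Q : Type*} [Ring R] [Ring Q] {f : R →+* Q}

theorem exists_eq_prodTI_left (hf : Function.Injective f) {M A : TwoSidedIdeal R}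
    (hM : IsInvertibleIdeal f M) (hA : A ≤ M) : ∃ B, A = prodTI M B := by
  obtain ⟨X, hl, _, hXM, hMX⟩ := isInvertibleIdeal_iff.1 hM
  refine ⟨comapTI f (X * imageTI f A) ?_ ?_, imageTI_injective hf ?_⟩
  · rw [← mul_assoc]
    exact mul_le_mul' hl le_rfl
  · rw [mul_assoc, imageTI_mul_top]
  · rw [imageTI_prodTI, imageTI_comapTI, ← mul_assoc, hMX, top_mul_imageTI]
    exact (mul_le_mul' le_rfl (imageTI_mono hA)).trans hXM.le

theorem exists_eq_prodTI_right (hf : Function.Injective f) {M A : TwoSidedIdeal R}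
    (hM : IsInvertibleIdeal f M) (hA : A ≤ M) : ∃ B, A = prodTI B M := by
  obtain ⟨X, _, hr, hXM, hMX⟩ := isInvertibleIdeal_iff.1 hM
  refine ⟨comapTI f (imageTI f A * X) ?_ ?_, imageTI_injective hf ?_⟩
  · rw [← mul_assoc, top_mul_imageTI]
  · rw [mul_assoc]
    exact mul_le_mul' le_rfl hr
  · rw [imageTI_prodTI, imageTI_comapTI, mul_assoc, hXM, imageTI_mul_top]
    exact (mul_le_mul' (imageTI_mono hA) le_rfl).trans hMX.le

theorem eq_top_of_prodTI_eq_self (hf : Function.Injective f) {M A : TwoSidedIdeal R}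
    (hA : IsInvertibleIdeal f A) (h : prodTI M A = A) : M = ⊤ := by
  obtain ⟨X, _, _, _, hAX⟩ := isInvertibleIdeal_iff.1 hA
  apply imageTI_injective hf
  have h' := congrArg (fun I => imageTI f I * X) h
  simpa only [imageTI_prodTI, mul_assoc, hAX, imageTI_mul_top] using h'

theorem inf_le_prodTI_of_sup_eq_top (hf : Function.Injective f) {A B : TwoSidedIdeal R}
    (hA : IsInvertibleIdeal f A) (h : A ⊔ B = ⊤) : A ⊓ B ≤ prodTI A B := by
  obtain ⟨C, hC⟩ := exists_eq_prodTI_left hf hA (inf_le_left (b := B))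
  have hCB : C ≤ B := by
    rw [← top_prodTI C, ← h, sup_prodTI, ← hC]
    exact sup_le inf_le_right (prodTI_le_left B C)
  rw [hC]
  exact prodTI_le.2 fun a ha c hc => prodTI_mem ha (hCB hc)

theorem prodTI_comm_of_sup_eq_top (hf : Function.Injective f) {A B : TwoSidedIdeal R}
    (hA : IsInvertibleIdeal f A) (hB : IsInvertibleIdeal f B) (h : A ⊔ B = ⊤) :
    prodTI A B = prodTI B A := by
  apply le_antisymm
  · refine le_trans (le_inf (prodTI_le_right A B) (prodTI_le_left A B)) ?_
    exact inf_le_prodTI_of_sup_eq_top hf hB (by rwa [sup_comm])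
  · refine le_trans (le_inf (prodTI_le_right B A) (prodTI_le_left B A)) ?_
    exact inf_le_prodTI_of_sup_eq_top hf hA h

/-- Nonzero ideals of a Noetherian Asano ring are products of maximal ideals. -/
theorem CondAsano.induction [IsNoetherianRing R] (hf : Function.Injective f) (h : CondAsano f)
    {P : TwoSidedIdeal R → Prop} (top : P ⊤)
    (mul : ∀ M B, IsCoatom M → M ≠ ⊥ → P B → P (prodTI M B))
    (A : TwoSidedIdeal R) (hA : A ≠ ⊥) : P A := by
  induction A using WellFoundedGT.induction with
  | ind A ih =>
    obtain rfl | ⟨M, hM, hAM⟩ := eq_top_or_exists_le_coatom A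
    · exact top
    have hM0 : M ≠ ⊥ := ne_bot_of_le_ne_bot hA hAM
    obtain ⟨B, rfl⟩ := exists_eq_prodTI_left hf (h M hM0) hAM
    have hB : B ≠ ⊥ := by
      rintro rfl
      exact hA (prodTI_bot M)
    refine mul M B hM hM0 (ih B (lt_of_le_of_ne (prodTI_le_right M B) fun e => ?_) hB)
    exact hM.1 (eq_top_of_prodTI_eq_self hf (h B hB) e)

theorem CondAsano.condComm [IsNoetherianRing R] (hf : Function.Injective f) (h : CondAsano f) :
    CondComm R := by
  intro A B
  by_cases hA : A = ⊥
  · rw [hA, prodTI_bot, bot_prodTI]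
  by_cases hB : B = ⊥
  · rw [hB, prodTI_bot, bot_prodTI]
  refine h.induction hf (P := fun A => prodTI A B = prodTI B A)
    (by rw [prodTI_top, top_prodTI]) (fun M C hM hM0 hC => ?_) A hA
  have hMB : prodTI M B = prodTI B M := by
    refine h.induction hf (P := fun B => prodTI M B = prodTI B M)
      (by rw [prodTI_top, top_prodTI]) (fun N D hN hN0 hD => ?_) B hB
    have hMN : prodTI M N = prodTI N M := by
      by_cases e : M = N
      · rw [e]
      · exact prodTI_comm_of_sup_eq_top hf (h M hM0) (h N hN0) (hM.sup_eq_top_of_ne hN e)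
    rw [← prodTI_assoc, hMN, prodTI_assoc, hD, prodTI_assoc]
  rw [prodTI_assoc, hC, ← prodTI_assoc, hMB, prodTI_assoc]

theorem CondAsano.condSDML [IsNoetherianRing R] (hf : Function.Injective f) (h : CondAsano f) :
    CondSDML R := by
  have hcomm := h.condComm hf
  refine ⟨hcomm, fun A B => ?_⟩
  rw [sumSet_colonSetL_eq_univ_iff, ← TwoSidedIdeal.mem_sup, TwoSidedIdeal.one_mem_iff]
  by_cases hD : A ⊔ B = ⊥
  · obtain ⟨rfl, rfl⟩ := sup_eq_bot_iff.1 hD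
    refine eq_top_iff.2 (le_trans (fun x _ => ?_) le_sup_left)
    exact mem_colonTI.2 fun b hb => TwoSidedIdeal.mul_mem_left _ _ _ hb
  obtain ⟨A', hA'⟩ := exists_eq_prodTI_right hf (h _ hD) (le_sup_left (a := A) (b := B))
  obtain ⟨B', hB'⟩ := exists_eq_prodTI_right hf (h _ hD) (le_sup_right (a := A) (b := B))
  have htop : A' ⊔ B' = ⊤ :=
    eq_top_of_prodTI_eq_self hf (h _ hD) (by rw [sup_prodTI, ← hA', ← hB'])
  have hAB : prodTI A' B ≤ A := by
    rw [hB', ← prodTI_assoc, hcomm A' B', prodTI_assoc, ← hA']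
    exact prodTI_le_right B' A
  have hBA : prodTI B' A ≤ B := by
    rw [hA', ← prodTI_assoc, hcomm B' A', prodTI_assoc, ← hB']
    exact prodTI_le_right A' B
  rw [eq_top_iff, ← htop]
  exact sup_le_sup (fun x hx => mem_colonTI.2 fun b hb => hAB (prodTI_mem hx hb))
    (fun x hx => mem_colonTI.2 fun a ha => hBA (prodTI_mem hx ha))

end Asano

section Converse

variable {R Q : Type*} [Ring R] [Ring Q] {f : R →+* Q}

theorem imageTI_iSup_eq {ι : Sort*} (J : ι → TwoSidedIdeal R) :
    imageTI f (⨆ j, J j) = ⨆ j, imageTI f (J j) := by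
  refine le_antisymm ?_ (iSup_le fun j => imageTI_mono (le_iSup J j))
  have hl : imageTI f ⊤ * (⨆ j, imageTI f (J j)) ≤ ⨆ j, imageTI f (J j) := by
    simp only [Submodule.mul_iSup, top_mul_imageTI, le_refl]
  have hr : (⨆ j, imageTI f (J j)) * imageTI f ⊤ ≤ ⨆ j, imageTI f (J j) := by
    simp only [Submodule.iSup_mul, imageTI_mul_top, le_refl]
  have h : ⨆ j, J j ≤ comapTI f _ hl hr := iSup_le fun j a ha =>
    mem_comapTI.2 (Submodule.mem_iSup_of_mem j (mem_imageTI.2 ⟨a, ha, rfl⟩))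
  intro q hq
  obtain ⟨a, ha, rfl⟩ := mem_imageTI.1 hq
  exact mem_comapTI.1 (h ha)

theorem isInvertibleIdeal_of_mul_eq {A : TwoSidedIdeal R} {X Y : Submodule ℤ Q}
    (hX : imageTI f A * X = imageTI f ⊤) (hY : Y * imageTI f A = imageTI f ⊤) :
    IsInvertibleIdeal f A := by
  have hT : imageTI f ⊤ * imageTI f ⊤ = imageTI f ⊤ := top_mul_imageTI ⊤
  have e : imageTI f ⊤ * X = Y * imageTI f ⊤ := by rw [← hY, mul_assoc, hX, hY]
  refine isInvertibleIdeal_iff.2 ⟨imageTI f ⊤ * X, ?_, ?_, ?_, ?_⟩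
  · rw [← mul_assoc, hT]
  · rw [e, mul_assoc, hT]
  · rw [e, mul_assoc, top_mul_imageTI, hY]
  · rw [← mul_assoc, imageTI_mul_top, hX]

theorem imageTI_mul_comm (h : CondComm R) (I J : TwoSidedIdeal R) :
    imageTI f I * imageTI f J = imageTI f J * imageTI f I := by
  rw [← imageTI_prodTI, h, imageTI_prodTI]

theorem imageTI_colonTI_mul_le (A B : TwoSidedIdeal R) :
    imageTI f (colonTI A B) * imageTI f B ≤ imageTI f A := by
  rw [← imageTI_prodTI]
  exact imageTI_mono (prodTI_le.2 fun _ hx b hb => mem_colonTI.1 hx b hb)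

theorem exists_imageTI_mul_eq_top {ι : Type*} {A : TwoSidedIdeal R} {J : ι → TwoSidedIdeal R}
    (hJ : ⨆ j, J j = ⊤)
    (h : ∀ j, ∃ X, imageTI f (J j) ≤ imageTI f A * X ∧ imageTI f A * X ≤ imageTI f ⊤) :
    ∃ X, imageTI f A * X = imageTI f ⊤ := by
  choose X h₁ h₂ using h
  refine ⟨⨆ j, X j, le_antisymm ?_ ?_⟩
  · rw [Submodule.mul_iSup]
    exact iSup_le h₂
  · rw [Submodule.mul_iSup, ← hJ, imageTI_iSup_eq]
    exact iSup_mono h₁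

theorem exists_mul_imageTI_eq_top {ι : Type*} {A : TwoSidedIdeal R} {J : ι → TwoSidedIdeal R}
    (hJ : ⨆ j, J j = ⊤)
    (h : ∀ j, ∃ X, imageTI f (J j) ≤ X * imageTI f A ∧ X * imageTI f A ≤ imageTI f ⊤) :
    ∃ X, X * imageTI f A = imageTI f ⊤ := by
  choose X h₁ h₂ using h
  refine ⟨⨆ j, X j, le_antisymm ?_ ?_⟩
  · rw [Submodule.iSup_mul]
    exact iSup_le h₂
  · rw [Submodule.iSup_mul, ← hJ, imageTI_iSup_eq]
    exact iSup_mono h₁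

theorem exists_imageTI_colonTI_le_mul (hcomm : CondComm R) {A C : TwoSidedIdeal R} {c : R}
    (hc : IsUnit (f c)) (hcA : c ∈ A) (hC : ∀ x ∈ C, ∃ r, x = r * c) :
    ∃ X, imageTI f (colonTI C A) ≤ imageTI f A * X ∧ imageTI f A * X ≤ imageTI f ⊤ := by
  obtain ⟨v, hv, _⟩ := isUnit_iff_exists.1 hc
  refine ⟨imageTI f (colonTI C A) * Submodule.span ℤ {v}, ?_, ?_⟩ <;>
    rw [← mul_assoc, imageTI_mul_comm hcomm]
  · intro q hq
    have := Submodule.mul_mem_mul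
      (Submodule.mul_mem_mul hq (mem_imageTI (f := f).2 ⟨c, hcA, rfl⟩))
      (Submodule.mem_span_singleton_self (R := ℤ) v)
    rwa [mul_assoc q, hv, mul_one] at this
  · refine (mul_le_mul' (imageTI_colonTI_mul_le C A) le_rfl).trans
      (Submodule.mul_le.2 fun p hp q hq => ?_)
    obtain ⟨x, hx, rfl⟩ := mem_imageTI.1 hp
    obtain ⟨r, rfl⟩ := hC x hx
    obtain ⟨n, rfl⟩ := Submodule.mem_span_singleton.1 hq
    refine mem_imageTI.2 ⟨n • r, TwoSidedIdeal.mem_top R, ?_⟩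
    rw [map_mul, mul_smul_comm, mul_assoc, hv, mul_one, map_zsmul]

theorem exists_imageTI_colonTI_le_mul' (hcomm : CondComm R) {A D : TwoSidedIdeal R} {d : R}
    (hd : IsUnit (f d)) (hdA : d ∈ A) (hD : ∀ x ∈ D, ∃ r, x = d * r) :
    ∃ X, imageTI f (colonTI D A) ≤ X * imageTI f A ∧ X * imageTI f A ≤ imageTI f ⊤ := by
  obtain ⟨v, _, hv⟩ := isUnit_iff_exists.1 hd
  refine ⟨Submodule.span ℤ {v} * imageTI f (colonTI D A), ?_, ?_⟩ <;> rw [mul_assoc]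
  · rw [imageTI_mul_comm hcomm]
    intro q hq
    have := Submodule.mul_mem_mul (Submodule.mem_span_singleton_self (R := ℤ) v)
      (Submodule.mul_mem_mul (mem_imageTI (f := f).2 ⟨d, hdA, rfl⟩) hq)
    rwa [← mul_assoc v, hv, one_mul] at this
  · refine (mul_le_mul' le_rfl (imageTI_colonTI_mul_le D A)).trans
      (Submodule.mul_le.2 fun q hq p hp => ?_)
    obtain ⟨x, hx, rfl⟩ := mem_imageTI.1 hp
    obtain ⟨r, rfl⟩ := hD x hx
    obtain ⟨n, rfl⟩ := Submodule.mem_span_singleton.1 hq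
    refine mem_imageTI.2 ⟨n • r, TwoSidedIdeal.mem_top R, ?_⟩
    rw [map_mul, smul_mul_assoc, ← mul_assoc, hv, one_mul, map_zsmul]

/-- A left principal ideal that is closed under right multiplication. -/
def leftPrincipalTI (c : R) (h : ∀ t, ∃ r, c * t = r * c) : TwoSidedIdeal R :=
  TwoSidedIdeal.mk' {x | ∃ r, x = r * c} ⟨0, by simp⟩
    (by rintro _ _ ⟨a, rfl⟩ ⟨b, rfl⟩; exact ⟨a + b, (add_mul _ _ _).symm⟩)
    (by rintro _ ⟨a, rfl⟩; exact ⟨-a, (neg_mul _ _).symm⟩)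
    (by rintro r _ ⟨a, rfl⟩; exact ⟨r * a, (mul_assoc _ _ _).symm⟩)
    (by
      rintro _ t ⟨a, rfl⟩
      obtain ⟨s, hs⟩ := h t
      exact ⟨a * s, by rw [mul_assoc, hs, mul_assoc]⟩)

/-- A right principal ideal that is closed under left multiplication. -/
def rightPrincipalTI (d : R) (h : ∀ t, ∃ r, t * d = d * r) : TwoSidedIdeal R :=
  TwoSidedIdeal.mk' {x | ∃ r, x = d * r} ⟨0, by simp⟩
    (by rintro _ _ ⟨a, rfl⟩ ⟨b, rfl⟩; exact ⟨a + b, (mul_add _ _ _).symm⟩)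
    (by rintro _ ⟨a, rfl⟩; exact ⟨-a, (mul_neg _ _).symm⟩)
    (by
      rintro t _ ⟨a, rfl⟩
      obtain ⟨s, hs⟩ := h t
      exact ⟨s * a, by rw [← mul_assoc, hs, mul_assoc]⟩)
    (by rintro _ r ⟨a, rfl⟩; exact ⟨a * r, mul_assoc _ _ _⟩)

theorem mem_leftPrincipalTI {c : R} {h : ∀ t, ∃ r, c * t = r * c} {x : R} :
    x ∈ leftPrincipalTI c h ↔ ∃ r, x = r * c :=
  TwoSidedIdeal.mem_mk' ..

theorem mem_rightPrincipalTI {d : R} {h : ∀ t, ∃ r, t * d = d * r} {x : R} :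
    x ∈ rightPrincipalTI d h ↔ ∃ r, x = d * r :=
  TwoSidedIdeal.mem_mk' ..

theorem eq_iSup_of_coe_eq_iSup_closure {ι : Sort*} {A : TwoSidedIdeal R} {S : ι → Set R}
    {C : ι → TwoSidedIdeal R} (hC : ∀ j x, x ∈ C j ↔ x ∈ S j)
    (hA : (A : Set R) = ↑(⨆ j, AddSubgroup.closure (S j))) : A = ⨆ j, C j := by
  have hmem : ∀ x, x ∈ A ↔ x ∈ ⨆ j, AddSubgroup.closure (S j) := fun x => Set.ext_iff.1 hA x
  apply le_antisymm
  · have : ⨆ j, AddSubgroup.closure (S j) ≤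
        (TwoSidedIdeal.asIdeal (⨆ j, C j)).toAddSubgroup :=
      iSup_le fun j => (AddSubgroup.closure_le _).2 fun x hx =>
        (le_iSup C j : C j ≤ _) ((hC j x).2 hx)
    exact fun x hx => this ((hmem x).1 hx)
  · exact iSup_le fun j x hx => (hmem x).2
      (AddSubgroup.mem_iSup_of_mem j (AddSubgroup.subset_closure ((hC j x).1 hx)))

theorem exists_imageTI_mul_eq_top_of_eq_iSup [IsNoetherianRing R]
    (hprime : ∀ I J : TwoSidedIdeal R, prodTI I J = ⊥ → I = ⊥ ∨ J = ⊥)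
    (hunit : ∀ s : R, IsRegular s → IsUnit (f s)) (h : CondSDML1 R)
    {ι : Type*} [Finite ι] {A : TwoSidedIdeal R} (hA : A ≠ ⊥) {c : ι → R}
    (hc : ∀ j t, ∃ r, c j * t = r * c j) (hAc : A = ⨆ j, leftPrincipalTI (c j) (hc j)) :
    ∃ X, imageTI f A * X = imageTI f ⊤ := by
  refine exists_imageTI_mul_eq_top (iSup_colonTI_eq_top hprime h hA hAc) fun j => ?_
  by_cases h0 : c j = 0
  · have hbot : leftPrincipalTI (c j) (hc j) = ⊥ := le_bot_iff.1 fun x hx => by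
      obtain ⟨r, rfl⟩ := mem_leftPrincipalTI.1 hx
      rw [h0, mul_zero]
      exact TwoSidedIdeal.zero_mem _
    refine ⟨⊥, ?_, ?_⟩
    · rw [hbot, colonTI_bot_eq_bot hprime hA, imageTI_bot]
      exact bot_le
    · rw [Submodule.mul_bot]
      exact bot_le
  · have hreg := isRegular_of_forall_mul_eq (eq_zero_or_eq_zero_of_prime hprime) h0 (hc j)
    have hcA : c j ∈ A := by
      rw [hAc]
      exact (le_iSup (fun j => leftPrincipalTI (c j) (hc j)) j)
        (mem_leftPrincipalTI.2 ⟨1, (one_mul _).symm⟩)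
    exact exists_imageTI_colonTI_le_mul h.1 (hunit _ hreg) hcA
      fun x hx => mem_leftPrincipalTI.1 hx

theorem exists_mul_imageTI_eq_top_of_eq_iSup [IsNoetherianRing Rᵐᵒᵖ]
    (hprime : ∀ I J : TwoSidedIdeal R, prodTI I J = ⊥ → I = ⊥ ∨ J = ⊥)
    (hunit : ∀ s : R, IsRegular s → IsUnit (f s)) (h : CondSDML1 R)
    {ι : Type*} [Finite ι] {A : TwoSidedIdeal R} (hA : A ≠ ⊥) {d : ι → R}
    (hd : ∀ j t, ∃ r, t * d j = d j * r) (hAd : A = ⨆ j, rightPrincipalTI (d j) (hd j)) :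
    ∃ X, X * imageTI f A = imageTI f ⊤ := by
  refine exists_mul_imageTI_eq_top (iSup_colonTI_eq_top hprime h hA hAd) fun j => ?_
  by_cases h0 : d j = 0
  · have hbot : rightPrincipalTI (d j) (hd j) = ⊥ := le_bot_iff.1 fun x hx => by
      obtain ⟨r, rfl⟩ := mem_rightPrincipalTI.1 hx
      rw [h0, zero_mul]
      exact TwoSidedIdeal.zero_mem _
    refine ⟨⊥, ?_, ?_⟩
    · rw [hbot, colonTI_bot_eq_bot hprime hA, imageTI_bot]
      exact bot_le
    · rw [Submodule.bot_mul]
      exact bot_le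
  · have hreg := isRegular_of_forall_mul_eq' (eq_zero_or_eq_zero_of_prime hprime) h0 (hd j)
    have hdA : d j ∈ A := by
      rw [hAd]
      exact (le_iSup (fun j => rightPrincipalTI (d j) (hd j)) j)
        (mem_rightPrincipalTI.2 ⟨1, (mul_one _).symm⟩)
    exact exists_imageTI_colonTI_le_mul' h.1 (hunit _ hreg) hdA
      fun x hx => mem_rightPrincipalTI.1 hx

end Converse

/-- For a prime Noetherian ring `R` with classical quotient ring `Q ⊇ R`:
(1) ⇒ (3), and (3), (4), (5) are pairwise equivalent; if moreover every ideal
`A` can be written `Rc₁ + ⋯ + Rc_m = A = d₁R + ⋯ + d_nR` with the `Rc_j`,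
`d_iR` two-sided ideals, then (1), (3), (4), (5) are all equivalent. -/
theorem stmt_17 {R Q : Type*} [Ring R] [Ring Q]
    [IsNoetherianRing R] [IsNoetherianRing Rᵐᵒᵖ]
    -- `R` is prime
    (hprime : ∀ I J : TwoSidedIdeal R, prodTI I J = ⊥ → I = ⊥ ∨ J = ⊥)
    -- the regular elements of `R` satisfy the left and right Ore conditions
    (horel : ∀ a s : R, IsRegular s → ∃ t b : R, IsRegular t ∧ t * a = b * s)
    (horer : ∀ a s : R, IsRegular s → ∃ t b : R, IsRegular t ∧ a * t = s * b)
    -- `Q` is the classical quotient ring of `R`, and `R ⊆ Q` via `f`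
    (f : R →+* Q)
    (hinj : Function.Injective f)
    (hunit : ∀ s : R, IsRegular s → IsUnit (f s))
    (hlfrac : ∀ q : Q, ∃ s a : R, IsRegular s ∧ f s * q = f a)
    (hrfrac : ∀ q : Q, ∃ s a : R, IsRegular s ∧ q * f s = f a) :
    (CondAsano f → CondSDML R) ∧
    (CondSDML R ↔ CondSDML1 R) ∧
    (CondSDML1 R ↔ CondSDML2 R) ∧
    ((∀ A : TwoSidedIdeal R, ∃ (m n : ℕ) (c : Fin m → R) (d : Fin n → R),
      (∀ j : Fin m, ∀ x ∈ {x : R | ∃ r : R, x = r * c j}, ∀ t : R,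
        x * t ∈ {x : R | ∃ r : R, x = r * c j}) ∧
      (∀ i : Fin n, ∀ x ∈ {x : R | ∃ r : R, x = d i * r}, ∀ t : R,
        t * x ∈ {x : R | ∃ r : R, x = d i * r}) ∧
      (A : Set R) = ↑(⨆ j : Fin m, AddSubgroup.closure {x : R | ∃ r : R, x = r * c j}) ∧
      (A : Set R) = ↑(⨆ i : Fin n, AddSubgroup.closure {x : R | ∃ r : R, x = d i * r})) →
      (CondSDML R → CondAsano f)) := by
  refine ⟨fun h => h.condSDML hinj, condSDML_iff_condSDML1,
    condSDML_iff_condSDML1.symm.trans condSDML_iff_condSDML2, fun hgen h A hA => ?_⟩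
  have h₁ := condSDML_iff_condSDML1.1 h
  obtain ⟨m, n, c, d, hc, hd, hAc, hAd⟩ := hgen A
  have hc' : ∀ j t, ∃ r, c j * t = r * c j := fun j t => hc j _ ⟨1, (one_mul _).symm⟩ t
  have hd' : ∀ i t, ∃ r, t * d i = d i * r := fun i t => hd i _ ⟨1, (mul_one _).symm⟩ t
  obtain ⟨X, hX⟩ := exists_imageTI_mul_eq_top_of_eq_iSup hprime hunit h₁ hA hc'
    (eq_iSup_of_coe_eq_iSup_closure (fun _ _ => mem_leftPrincipalTI) hAc)
  obtain ⟨Y, hY⟩ := exists_mul_imageTI_eq_top_of_eq_iSup hprime hunit h₁ hA hd'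
    (eq_iSup_of_coe_eq_iSup_closure (fun _ _ => mem_rightPrincipalTI) hAd)
  exact isInvertibleIdeal_of_mul_eq hX hY
end
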